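/- arXiv:cs/0509014 — 5 statements merged into one kernel-verified Lean document; each statement's English description precedes it below -/
import Mathlib

section
/- Let λ(x) = Σ_{k=2}^{K} λ_k x^{k-1} be a polynomial with λ_k ≥ 0 and Σ_k λ_k = 1, let d > 0 and r > 0 be real numbers with λ_2·d·r < 1, and set ε* := inf{ε > 0 : r·λ(d·ε) ≥ ε} (with inf ∅ = +∞), which is strictly positive. If (c_l)_{l≥0} is a sequence of nonnegative reals satisfying c_{l+1} ≤ r·λ(d·c_l) for all l, and c_{l0} < ε* for some index l0, then c_l remains below ε* for all l ≥ l0 and lim_{l→∞} c_l = 0. -/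
open Finset Filter Topology
open scoped ENNReal

/-- Convergence part of the sufficient stability condition: if the
Bhattacharyya-type sequence `c` satisfies `c (l+1) ≤ r * λ(d * c l)` and
drops strictly below the stability threshold `ε*` at some iteration `l0`,
then it stays below `ε*` and converges to `0`. -/
theorem stability_sufficient_convergence
    (K : ℕ) (hK : 2 ≤ K) (lam : ℕ → ℝ)
    (hlam_nonneg : ∀ k, 0 ≤ lam k)
    (hlam_sum : ∑ k ∈ Finset.Icc 2 K, lam k = 1)
    (L : ℝ → ℝ)
    (hL : ∀ x, L x = ∑ k ∈ Finset.Icc 2 K, lam k * x ^ (k - 1))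
    (d r : ℝ) (hd : 0 < d) (hr : 0 < r)
    (hstab : lam 2 * d * r < 1)
    (εstar : ℝ≥0∞)
    (hεstar : εstar =
      sInf {ε : ℝ≥0∞ | 0 < ε ∧ ε ≠ ⊤ ∧ ε.toReal ≤ r * L (d * ε.toReal)})
    (c : ℕ → ℝ) (hc_nonneg : ∀ l, 0 ≤ c l)
    (hrec : ∀ l, c (l + 1) ≤ r * L (d * c l))
    (l0 : ℕ) (hinit : ENNReal.ofReal (c l0) < εstar) :
    0 < εstar ∧
    (∀ l, l0 ≤ l → ENNReal.ofReal (c l) < εstar) ∧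
    Tendsto c atTop (𝓝 0) := by
  have key : ∀ x : ℝ, 0 < x → ENNReal.ofReal x < εstar → r * L (d * x) < x := by
    intro x hx hlt
    by_contra hcon
    push Not at hcon
    have hmem : εstar ≤ ENNReal.ofReal x := by
      rw [hεstar]
      apply sInf_le
      refine ⟨ENNReal.ofReal_pos.2 hx, ENNReal.ofReal_ne_top, ?_⟩
      rw [ENNReal.toReal_ofReal hx.le]
      exact hcon
    exact absurd hlt (not_lt.2 hmem)
  have hL0 : L 0 = 0 := by
    rw [hL]
    apply Finset.sum_eq_zero
    intro k hk
    have h2 := (Finset.mem_Icc.1 hk).1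
    rw [zero_pow (by omega), mul_zero]
  have hLc : Continuous L := by
    have h : L = fun x => ∑ k ∈ Finset.Icc 2 K, lam k * x ^ (k - 1) := funext hL
    rw [h]
    fun_prop
  have hstep : ∀ l, ENNReal.ofReal (c l) < εstar → c (l + 1) ≤ c l := by
    intro l hl
    rcases (hc_nonneg l).eq_or_lt with h0 | hpos
    · have h1 := hrec l
      rw [← h0, mul_zero, hL0, mul_zero] at h1
      rw [← h0]
      exact h1
    · exact (hrec l).trans (key _ hpos hl).le
  have hbelow : ∀ l, l0 ≤ l → ENNReal.ofReal (c l) < εstar := by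
    intro l hl
    induction l, hl using Nat.le_induction with
    | base => exact hinit
    | succ n _ ih => exact (ENNReal.ofReal_le_ofReal (hstep n ih)).trans_lt ih
  refine ⟨zero_le.trans_lt hinit, hbelow, ?_⟩
  have hanti : Antitone (fun n => c (n + l0)) := by
    apply antitone_nat_of_succ_le
    intro n
    have h := hstep (n + l0) (hbelow _ (by omega))
    rwa [show n + l0 + 1 = n + 1 + l0 by omega] at h
  have hbdd : BddBelow (Set.range (fun n => c (n + l0))) :=
    ⟨0, by rintro _ ⟨n, rfl⟩; exact hc_nonneg _⟩
  obtain ⟨a, ha⟩ : ∃ a, Tendsto (fun n => c (n + l0)) atTop (𝓝 a) :=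
    ⟨_, tendsto_atTop_ciInf hanti hbdd⟩
  have hca : Tendsto c atTop (𝓝 a) := (tendsto_add_atTop_iff_nat l0).1 ha
  have ha0 : 0 ≤ a := ge_of_tendsto' ha (fun n => hc_nonneg _)
  have hale : a ≤ c l0 := by
    have h := hanti.le_of_tendsto ha 0
    simpa using h
  have hfix : a ≤ r * L (d * a) := by
    have h1 : Tendsto (fun l => c (l + 1)) atTop (𝓝 a) :=
      (tendsto_add_atTop_iff_nat 1).2 hca
    have hcont : Continuous (fun x => r * L (d * x)) := by fun_prop
    exact le_of_tendsto_of_tendsto' h1 ((hcont.tendsto a).comp hca) hrec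
  rcases ha0.eq_or_lt with h0 | hpos
  · rw [h0]
    exact hca
  · exact absurd (key a hpos ((ENNReal.ofReal_le_ofReal hale).trans_lt hinit)) (not_lt.2 hfix)
end

section
/- Let λ(x) = Σ_{k=2}^{K} λ_k x^{k-1} be a polynomial with λ_k ≥ 0, Σ_k λ_k = 1 and λ_2 > 0, let d > 0 and r > 0 be reals with λ_2·d·r < 1, and set ε* := inf{ε > 0 : r·λ(d·ε) ≥ ε} (inf ∅ = +∞). If (c_l)_{l≥0} is a sequence of nonnegative reals with c_{l+1} ≤ r·λ(d·c_l) for all l and c_{l0} < ε* for some l0, then there exists a constant C > 0 such that c_l ≤ C·(λ_2·d·r)^l for all l, i.e., c_l converges to 0 geometrically with ratio λ_2·d·r. -/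
open Finset Filter Topology
open scoped ENNReal

/-- Abstract quadratic recursion: geometric decay with the exact linear ratio. -/
lemma quad_rec_rate (q a : ℝ) (hq : 0 < q) (ha : 0 ≤ a) (hs : q + a < 1) (u : ℕ → ℝ)
    (hu : ∀ n, 0 ≤ u n) (h0 : u 0 ≤ 1)
    (hrec : ∀ n, u n ≤ 1 → u (n + 1) ≤ q * u n + a * u n ^ 2) :
    ∃ C : ℝ, 0 < C ∧ ∀ n, u n ≤ C * q ^ n := by
  have hs0 : 0 < q + a := by linarith
  have h1 : ∀ n, u n ≤ (q + a) ^ n := by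
    intro n
    induction n with
    | zero => simpa using h0
    | succ n ih =>
      have hle : u n ≤ 1 := ih.trans (pow_le_one₀ hs0.le hs.le)
      have h2 := hrec n hle
      have h3 : u n ^ 2 ≤ u n := by nlinarith [hu n]
      have h4 : a * u n ^ 2 ≤ a * u n := mul_le_mul_of_nonneg_left h3 ha
      have h5 : (q + a) * u n ≤ (q + a) * (q + a) ^ n := mul_le_mul_of_nonneg_left ih hs0.le
      rw [pow_succ]
      linarith
  have h2 : ∀ n, u n ≤ q ^ n * Real.exp (a / q * ∑ i ∈ Finset.range n, (q + a) ^ i) := by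
    intro n
    induction n with
    | zero => simpa using h0
    | succ n ih =>
      have hle : u n ≤ 1 := (h1 n).trans (pow_le_one₀ hs0.le hs.le)
      have h3 := hrec n hle
      rw [Finset.sum_range_succ, mul_add, Real.exp_add]
      have h4 : q * u n + a * u n ^ 2 = u n * (q * (a / q * u n + 1)) := by
        field_simp
        ring
      have h5 : a / q * u n + 1 ≤ Real.exp (a / q * (q + a) ^ n) := by
        refine le_trans ?_ (Real.add_one_le_exp _)
        have := mul_le_mul_of_nonneg_left (h1 n) (div_nonneg ha hq.le)
        linarith
      have h6 : 0 ≤ a / q * u n := mul_nonneg (div_nonneg ha hq.le) (hu n)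
      calc u (n + 1) ≤ u n * (q * (a / q * u n + 1)) := by rw [← h4]; exact h3
        _ ≤ (q ^ n * Real.exp (a / q * ∑ i ∈ Finset.range n, (q + a) ^ i)) *
            (q * Real.exp (a / q * (q + a) ^ n)) := by
          apply mul_le_mul ih (mul_le_mul_of_nonneg_left h5 hq.le) _ _
          · positivity
          · positivity
        _ = _ := by ring
  refine ⟨Real.exp (a / q * (1 - (q + a))⁻¹), Real.exp_pos _, fun n => (h2 n).trans ?_⟩
  rw [mul_comm]
  apply mul_le_mul_of_nonneg_right _ (by positivity)
  apply Real.exp_le_exp.mpr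
  apply mul_le_mul_of_nonneg_left _ (div_nonneg ha hq.le)
  rw [← tsum_geometric_of_lt_one hs0.le hs]
  exact (summable_geometric_of_lt_one hs0.le hs).sum_le_tsum _ (fun i _ => by positivity)

/-- Convergence-rate part (case `λ₂ > 0`) of the sufficient stability
condition: once the sequence drops below the stability threshold `ε*`,
it converges to `0` geometrically with ratio `λ₂ * d * r`. -/
theorem stability_sufficient_rate_lambda2_pos
    (K : ℕ) (hK : 2 ≤ K) (lam : ℕ → ℝ)
    (hlam_nonneg : ∀ k, 0 ≤ lam k)
    (hlam_sum : ∑ k ∈ Finset.Icc 2 K, lam k = 1)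
    (hlam2_pos : 0 < lam 2)
    (L : ℝ → ℝ)
    (hL : ∀ x, L x = ∑ k ∈ Finset.Icc 2 K, lam k * x ^ (k - 1))
    (d r : ℝ) (hd : 0 < d) (hr : 0 < r)
    (hstab : lam 2 * d * r < 1)
    (εstar : ℝ≥0∞)
    (hεstar : εstar =
      sInf {ε : ℝ≥0∞ | 0 < ε ∧ ε ≠ ⊤ ∧ ε.toReal ≤ r * L (d * ε.toReal)})
    (c : ℕ → ℝ) (hc_nonneg : ∀ l, 0 ≤ c l)
    (hrec : ∀ l, c (l + 1) ≤ r * L (d * c l))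
    (l0 : ℕ) (hinit : ENNReal.ofReal (c l0) < εstar) :
    ∃ C : ℝ, 0 < C ∧ ∀ l : ℕ, c l ≤ C * (lam 2 * d * r) ^ l := by
  have hq : 0 < lam 2 * d * r := by positivity
  obtain ⟨e, he1, he2⟩ := exists_between hinit
  have he0 : 0 < e := lt_of_le_of_lt (zero_le) he1
  have het : e ≠ ⊤ := ne_top_of_lt he2
  obtain ⟨b, hb⟩ : ∃ b, b = e.toReal := ⟨_, rfl⟩
  have hb0 : 0 < b := hb ▸ ENNReal.toReal_pos he0.ne' het
  have hcb : c l0 ≤ b := by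
    rw [hb]
    exact (ENNReal.ofReal_le_iff_le_toReal het).mp he1.le
  have hfb : r * L (d * b) < b := by
    by_contra hcon
    rw [not_lt] at hcon
    have : εstar ≤ e := by
      rw [hεstar]
      exact sInf_le ⟨he0, het, by rw [← hb]; exact hcon⟩
    exact absurd he2 (not_lt.mpr this)
  have hsplit : ∀ x, L x = lam 2 * x + ∑ k ∈ Finset.Icc 3 K, lam k * x ^ (k - 1) := by
    intro x
    rw [hL, ← Finset.add_sum_Ioc_eq_sum_Icc hK]
    have : Finset.Ioc 2 K = Finset.Icc 3 K := by ext k; simp; omega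
    rw [this]
    simp
  obtain ⟨R, hR⟩ : ∃ R, R = ∑ k ∈ Finset.Icc 3 K, lam k * (d * b) ^ (k - 1) := ⟨_, rfl⟩
  have hR0 : 0 ≤ R := by
    rw [hR]
    exact Finset.sum_nonneg fun k _ => mul_nonneg (hlam_nonneg k) (by positivity)
  have hkey : ∀ t, 0 ≤ t → t ≤ 1 → L (d * (t * b)) ≤ lam 2 * (d * (t * b)) + t ^ 2 * R := by
    intro t ht0 ht1
    rw [hsplit, hR, Finset.mul_sum]
    refine add_le_add le_rfl (Finset.sum_le_sum fun k hk => ?_)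
    rw [Finset.mem_Icc] at hk
    have h1 : t ^ (k - 1) ≤ t ^ 2 := pow_le_pow_of_le_one ht0 ht1 (by omega)
    have h2 : 0 ≤ lam k * (d * b) ^ (k - 1) := mul_nonneg (hlam_nonneg k) (by positivity)
    calc lam k * (d * (t * b)) ^ (k - 1) = t ^ (k - 1) * (lam k * (d * b) ^ (k - 1)) := by
          rw [show d * (t * b) = t * (d * b) by ring, mul_pow]; ring
      _ ≤ _ := mul_le_mul_of_nonneg_right h1 h2
  obtain ⟨C, hC, hCu⟩ := quad_rec_rate (lam 2 * d * r) (r * R / b) hq (by positivity)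
    (by
      rw [hsplit, ← hR] at hfb
      have : lam 2 * d * r + r * R / b = (r * (lam 2 * (d * b) + R)) / b := by field_simp
      rw [this, div_lt_one hb0]
      exact hfb)
    (fun n => c (l0 + n) / b) (fun n => div_nonneg (hc_nonneg _) hb0.le)
    (by simpa using (div_le_one hb0).mpr hcb)
    (by
      intro n hn
      have h1 := hkey (c (l0 + n) / b) (div_nonneg (hc_nonneg _) hb0.le) hn
      rw [div_mul_cancel₀ _ hb0.ne'] at h1
      have h2 := (hrec (l0 + n)).trans (mul_le_mul_of_nonneg_left h1 hr.le)
      show c (l0 + n + 1) / b ≤ _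
      rw [div_le_iff₀ hb0]
      refine h2.trans (le_of_eq ?_)
      field_simp)
  obtain ⟨q, hqq⟩ : ∃ q, q = lam 2 * d * r := ⟨_, rfl⟩
  rw [← hqq] at hq hCu ⊢
  have hsum : 0 ≤ ∑ l ∈ Finset.range l0, c l / q ^ l :=
    Finset.sum_nonneg fun l _ => div_nonneg (hc_nonneg l) (by positivity)
  refine ⟨C * b / q ^ l0 + ∑ l ∈ Finset.range l0, c l / q ^ l, by positivity, fun l => ?_⟩
  rw [← div_le_iff₀ (by positivity)]
  rcases lt_or_ge l l0 with h | h
  · have h1 : c l / q ^ l ≤ ∑ l ∈ Finset.range l0, c l / q ^ l :=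
      Finset.single_le_sum (f := fun l => c l / q ^ l)
        (fun l _ => div_nonneg (hc_nonneg l) (by positivity)) (Finset.mem_range.mpr h)
    have : 0 ≤ C * b / q ^ l0 := by positivity
    linarith
  · obtain ⟨n, rfl⟩ := Nat.exists_eq_add_of_le h
    have h1 := hCu n
    rw [div_le_iff₀ hb0] at h1
    have h2 : c (l0 + n) / q ^ (l0 + n) ≤ C * b / q ^ l0 := by
      rw [div_le_div_iff₀ (by positivity) (by positivity), pow_add]
      have := mul_le_mul_of_nonneg_right h1 (pow_pos hq l0).le
      linarith
    linarith
end

section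
/- Let λ(x) = Σ_{k=2}^{K} λ_k x^{k-1} be a polynomial with λ_k ≥ 0, Σ_k λ_k = 1 and λ_2 = 0, let k_λ := min{k : λ_k > 0} (so k_λ ≥ 3), let d > 0 and r > 0 be reals, and set ε* := inf{ε > 0 : r·λ(d·ε) ≥ ε} (inf ∅ = +∞), which is strictly positive. If (c_l)_{l≥0} is a sequence of nonnegative reals with c_{l+1} ≤ r·λ(d·c_l) for all l and c_{l0} < ε* for some l0, then there exist β > 0 and L ∈ ℕ such that c_l ≤ exp(−β·(k_λ−1)^l) for all l ≥ L; in particular c_l → 0 doubly exponentially fast. -/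
open Finset Filter Topology
open scoped ENNReal

/-- Convergence-rate part (case `λ₂ = 0`) of the sufficient stability
condition: once the sequence drops below the stability threshold `ε*`,
it converges to `0` doubly exponentially fast, with inner rate
`(k_λ - 1)^l` where `k_λ = min {k : λ_k > 0}`. -/
theorem stability_sufficient_rate_lambda2_zero
    (K : ℕ) (hK : 2 ≤ K) (lam : ℕ → ℝ)
    (hlam_nonneg : ∀ k, 0 ≤ lam k)
    (hlam_sum : ∑ k ∈ Finset.Icc 2 K, lam k = 1)
    (hlam2_zero : lam 2 = 0)
    (klam : ℕ)
    (hklam_pos : 0 < lam klam)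
    (hklam_min : ∀ k, 0 < lam k → klam ≤ k)
    (L : ℝ → ℝ)
    (hL : ∀ x, L x = ∑ k ∈ Finset.Icc 2 K, lam k * x ^ (k - 1))
    (d r : ℝ) (hd : 0 < d) (hr : 0 < r)
    (εstar : ℝ≥0∞)
    (hεstar : εstar =
      sInf {ε : ℝ≥0∞ | 0 < ε ∧ ε ≠ ⊤ ∧ ε.toReal ≤ r * L (d * ε.toReal)})
    (c : ℕ → ℝ) (hc_nonneg : ∀ l, 0 ≤ c l)
    (hrec : ∀ l, c (l + 1) ≤ r * L (d * c l))
    (l0 : ℕ) (hinit : ENNReal.ofReal (c l0) < εstar) :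
    ∃ β : ℝ, 0 < β ∧ ∃ N : ℕ, ∀ l : ℕ, N ≤ l →
      c l ≤ Real.exp (-β * ((klam : ℝ) - 1) ^ l) := by
  have hL0 : L 0 = 0 := by
    rw [hL]
    refine Finset.sum_eq_zero fun k hk => ?_
    have := (Finset.mem_Icc.1 hk).1
    rw [zero_pow (by omega), mul_zero]
  -- geometric contraction
  have hscale : ∀ x a : ℝ, 0 ≤ x → x ≤ a → L (d * x) * a ≤ x * L (d * a) := by
    intro x a hx hxa
    rw [hL, hL, Finset.sum_mul, Finset.mul_sum]
    refine Finset.sum_le_sum fun k hk => ?_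
    obtain ⟨j, rfl⟩ : ∃ j, k = j + 2 := ⟨k - 2, by have := (Finset.mem_Icc.1 hk).1; omega⟩
    have e : j + 2 - 1 = j + 1 := by omega
    rw [e, mul_pow, mul_pow, pow_succ x, pow_succ a]
    have h1 : x ^ j ≤ a ^ j := pow_le_pow_left₀ hx hxa j
    have h2 : 0 ≤ lam (j + 2) * d ^ (j + 1) * (x * a) := by
      have := hlam_nonneg (j + 2)
      have := hx.trans hxa
      positivity
    nlinarith [mul_le_mul_of_nonneg_left h1 h2]
  have hLnn : ∀ x, 0 ≤ x → 0 ≤ L x := by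
    intro x hx
    rw [hL]
    exact Finset.sum_nonneg fun k _ => mul_nonneg (hlam_nonneg k) (pow_nonneg hx _)
  have hq : ∃ q : ℝ, 0 ≤ q ∧ q < 1 ∧ ∀ x, 0 ≤ x → x ≤ c l0 → r * L (d * x) ≤ q * x := by
    rcases (hc_nonneg l0).eq_or_lt with h0 | h0
    · refine ⟨0, le_rfl, one_pos, fun x hx hxa => ?_⟩
      have : x = 0 := by linarith
      subst this
      simp [hL0]
    · have hlt : r * L (d * c l0) < c l0 := by
        by_contra hcon
        push Not at hcon
        refine absurd hinit (not_lt.2 ?_)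
        rw [hεstar]
        refine sInf_le ⟨ENNReal.ofReal_pos.2 h0, ENNReal.ofReal_ne_top, ?_⟩
        rwa [ENNReal.toReal_ofReal h0.le]
      refine ⟨r * L (d * c l0) / c l0, ?_, (div_lt_one h0).2 hlt, fun x hx hxa => ?_⟩
      · have := hLnn (d * c l0) (by positivity)
        positivity
      · rw [div_mul_eq_mul_div, le_div_iff₀ h0]
        nlinarith [mul_le_mul_of_nonneg_left (hscale x _ hx hxa) hr.le]
  obtain ⟨q, hq0, hq1, hqc⟩ := hq
  have hgeo : ∀ j, c (l0 + j) ≤ q ^ j * c l0 := by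
    intro j
    induction j with
    | zero => simp
    | succ j ih =>
      have h1 : c (l0 + j) ≤ c l0 :=
        ih.trans (mul_le_of_le_one_left (hc_nonneg _) (pow_le_one₀ hq0 hq1.le))
      have h2 := (hrec (l0 + j)).trans (hqc _ (hc_nonneg _) h1)
      have h3 := mul_le_mul_of_nonneg_left ih hq0
      rw [← add_assoc, pow_succ]
      linarith
  have hlim : Tendsto c atTop (𝓝 0) := by
    rw [← tendsto_add_atTop_iff_nat l0]
    have hg : Tendsto (fun j => q ^ j * c l0) atTop (𝓝 0) := by
      simpa using (tendsto_pow_atTop_nhds_zero_of_lt_one hq0 hq1).mul_const (c l0)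
    refine squeeze_zero (fun j => hc_nonneg _) (fun j => ?_) hg
    rw [add_comm]
    exact hgeo j
  have hsmall : ∀ δ : ℝ, 0 < δ → ∃ N, ∀ l, N ≤ l → c l ≤ δ := by
    intro δ hδ
    exact eventually_atTop.1 ((hlim.eventually_lt_const hδ).mono fun _ h => h.le)
  by_cases hk3 : klam < 3
  · -- degenerate possibility (positive mass outside the support range)
    obtain ⟨N, hN⟩ := hsmall (Real.exp (-1)) (Real.exp_pos _)
    refine ⟨1, one_pos, N, fun l hl => (hN l hl).trans (Real.exp_le_exp.2 ?_)⟩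
    have h1 : |(klam : ℝ) - 1| ≤ 1 := by
      interval_cases klam <;> norm_num
    have h2 : |((klam : ℝ) - 1) ^ l| ≤ 1 := by
      rw [abs_pow]
      exact pow_le_one₀ (abs_nonneg _) h1
    have := (abs_le.1 h2).2
    linarith
  obtain ⟨m, rfl⟩ : ∃ m, klam = m + 1 := ⟨klam - 1, by omega⟩
  have hm : 2 ≤ m := by omega
  have hLm : ∀ x, 0 ≤ x → x ≤ 1 → L x ≤ x ^ m := by
    intro x hx hx1
    have : x ^ m = ∑ k ∈ Finset.Icc 2 K, lam k * x ^ m := by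
      rw [← Finset.sum_mul, hlam_sum, one_mul]
    rw [hL, this]
    refine Finset.sum_le_sum fun k hk => ?_
    rcases (hlam_nonneg k).eq_or_lt with h | h
    · rw [← h]; simp
    · have := hklam_min k h
      exact mul_le_mul_of_nonneg_left (pow_le_pow_of_le_one hx hx1 (by omega)) h.le
  set M : ℝ := max 1 (r * d ^ m) with hM
  have hM1 : 1 ≤ M := le_max_left _ _
  have hM2 : r * d ^ m ≤ M := le_max_right _ _
  have hM0 : 0 < M := by linarith
  obtain ⟨N1, hN1⟩ := hsmall (1 / d) (by positivity)
  obtain ⟨N2, hN2⟩ := hsmall (Real.exp (-1) / M) (by positivity)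
  have hstep : ∀ l, N1 ≤ l → M * c (l + 1) ≤ (M * c l) ^ m := by
    intro l hl
    have h1 : d * c l ≤ 1 := by
      have := (le_div_iff₀ hd).1 (hN1 l hl)
      linarith
    have h2 := hLm (d * c l) (mul_nonneg hd.le (hc_nonneg l)) h1
    have hcm : 0 ≤ c l ^ m := pow_nonneg (hc_nonneg l) m
    have h3 : c (l + 1) ≤ M * c l ^ m := by
      calc c (l + 1) ≤ r * (d * c l) ^ m := (hrec l).trans (mul_le_mul_of_nonneg_left h2 hr.le)
        _ = r * d ^ m * c l ^ m := by rw [mul_pow]; ring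
        _ ≤ M * c l ^ m := mul_le_mul_of_nonneg_right hM2 hcm
    calc M * c (l + 1) ≤ M * (M * c l ^ m) := mul_le_mul_of_nonneg_left h3 hM0.le
      _ = M ^ 2 * c l ^ m := by ring
      _ ≤ M ^ m * c l ^ m := mul_le_mul_of_nonneg_right (pow_le_pow_right₀ hM1 hm) hcm
      _ = (M * c l) ^ m := (mul_pow _ _ _).symm
  set N := max N1 N2 with hN
  have hmain : ∀ j : ℕ, M * c (N + j) ≤ Real.exp (-(m : ℝ) ^ j) := by
    intro j
    induction j with
    | zero =>
      have := (le_div_iff₀ hM0).1 (hN2 N (le_max_right _ _))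
      simp only [add_zero, pow_zero]
      linarith
    | succ j ih =>
      have h1 := hstep (N + j) ((le_max_left N1 N2).trans (Nat.le_add_right _ _))
      refine h1.trans ((pow_le_pow_left₀ (mul_nonneg hM0.le (hc_nonneg _)) ih m).trans ?_)
      rw [← Real.exp_nat_mul, pow_succ]
      exact Real.exp_le_exp.2 (by linarith)
  have hmpos : (0 : ℝ) < m := by
    have : 0 < m := by omega
    exact_mod_cast this
  refine ⟨((m : ℝ) ^ N)⁻¹, by positivity, N, fun l hl => ?_⟩
  obtain ⟨j, rfl⟩ := Nat.exists_eq_add_of_le hl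
  have h1 : c (N + j) ≤ M * c (N + j) := le_mul_of_one_le_left (hc_nonneg _) hM1
  have h2 : -((m : ℝ) ^ N)⁻¹ * (((m + 1 : ℕ) : ℝ) - 1) ^ (N + j) = -(m : ℝ) ^ j := by
    push_cast
    rw [add_sub_cancel_right, pow_add]
    field_simp
  rw [h2]
  exact h1.trans (hmain j)
end

section
/- Let λ(x) = Σ_{k=2}^{K} λ_k x^{k-1} be a polynomial with λ_k ≥ 0 and Σ_k λ_k = 1, and suppose λ_k > 0 for some k ≥ 3. Let d > 0 and r > 0 be reals with λ_2·d·r < 1 (so in particular r·λ(d) − r·λ_2·d > 0). Then for every ε with 0 < ε ≤ 1 and ε < (1 − λ_2·d·r)/(r·λ(d) − r·λ_2·d), one has r·λ(d·ε) < ε. Consequently the smallest strictly positive root ε* of the equation r·λ(d·ε) = ε (if it exists) satisfies ε* ≥ min(1, (1 − λ_2·d·r)/(r·λ(d) − r·λ_2·d)). -/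
open Finset

/-- Lower bound on the stability region: for every
`0 < ε ≤ 1` with `ε < (1 - λ₂ d r)/(r λ(d) - r λ₂ d)` one has
`r λ(d ε) < ε`; consequently the smallest strictly positive root `ε*` of
`r λ(d ε) = ε` (if it exists) is at least
`min 1 ((1 - λ₂ d r)/(r λ(d) - r λ₂ d))`. -/
theorem stability_region_lower_bound
    (K : ℕ) (hK : 2 ≤ K) (lam : ℕ → ℝ)
    (hlam_nonneg : ∀ k, 0 ≤ lam k)
    (hlam_sum : ∑ k ∈ Finset.Icc 2 K, lam k = 1)
    (hlam_high : ∃ k, 3 ≤ k ∧ k ≤ K ∧ 0 < lam k)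
    (L : ℝ → ℝ)
    (hL : ∀ x, L x = ∑ k ∈ Finset.Icc 2 K, lam k * x ^ (k - 1))
    (d r : ℝ) (hd : 0 < d) (hr : 0 < r)
    (hstab : lam 2 * d * r < 1) :
    (∀ ε : ℝ, 0 < ε → ε ≤ 1 →
        ε < (1 - lam 2 * d * r) / (r * L d - r * lam 2 * d) →
        r * L (d * ε) < ε) ∧
    (∀ εstar : ℝ, 0 < εstar → r * L (d * εstar) = εstar →
        (∀ ε' : ℝ, 0 < ε' → r * L (d * ε') = ε' → εstar ≤ ε') →
        min 1 ((1 - lam 2 * d * r) / (r * L d - r * lam 2 * d)) ≤ εstar) := by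
  have hsplit : ∀ x, L x = lam 2 * x + ∑ k ∈ Finset.Ioc 2 K, lam k * x ^ (k - 1) := by
    intro x
    rw [hL, ← Finset.add_sum_Ioc_eq_sum_Icc hK]
    norm_num
  have hS : 0 < ∑ k ∈ Finset.Ioc 2 K, lam k * d ^ (k - 1) := by
    obtain ⟨k, hk3, hkK, hk⟩ := hlam_high
    refine Finset.sum_pos' (fun i _ => mul_nonneg (hlam_nonneg i) (by positivity)) ⟨k, ?_, ?_⟩
    · rw [Finset.mem_Ioc]; omega
    · positivity
  have hden : r * L d - r * lam 2 * d = r * ∑ k ∈ Finset.Ioc 2 K, lam k * d ^ (k - 1) := by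
    rw [hsplit d]; ring
  have hbound : ∀ ε : ℝ, 0 < ε → ε ≤ 1 →
      ∑ k ∈ Finset.Ioc 2 K, lam k * (d * ε) ^ (k - 1)
        ≤ ε ^ 2 * ∑ k ∈ Finset.Ioc 2 K, lam k * d ^ (k - 1) := by
    intro ε h0 h1
    rw [Finset.mul_sum]
    refine Finset.sum_le_sum fun k hk => ?_
    rw [Finset.mem_Ioc] at hk
    have hp : ε ^ (k - 1) ≤ ε ^ 2 := pow_le_pow_of_le_one h0.le h1 (by omega)
    have hc : 0 ≤ lam k * d ^ (k - 1) := mul_nonneg (hlam_nonneg k) (by positivity)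
    rw [mul_pow]
    nlinarith [mul_le_mul_of_nonneg_left hp hc]
  have main : ∀ ε : ℝ, 0 < ε → ε ≤ 1 →
      ε < (1 - lam 2 * d * r) / (r * L d - r * lam 2 * d) → r * L (d * ε) < ε := by
    intro ε h0 h1 h
    rw [hden, lt_div_iff₀ (mul_pos hr hS)] at h
    have hb := mul_le_mul_of_nonneg_left (hbound ε h0 h1) hr.le
    have hm := mul_lt_mul_of_pos_left h h0
    rw [hsplit]
    nlinarith
  refine ⟨main, fun εs h0 hroot _ => ?_⟩
  by_contra hlt
  rw [not_le, lt_min_iff] at hlt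
  exact absurd hroot (main εs h0 hlt.1.le hlt.2).ne
end

section
/- Let ε_0, ε_1 ≥ 0 with ε_0 + ε_1 < 1, let r be a real number, and set L_+ := ln((1−ε_0+ε_1)/(1−ε_0−ε_1)) and L_− := ln((1+ε_0−ε_1)/(1−ε_0−ε_1)). Then lim_{Δ→∞} ( ((1−ε_0+ε_1)·e^{i(r/Δ)L_+} − (1+ε_0−ε_1)·e^{i(r/Δ)L_−}) / 2 )^Δ = 0 in ℂ; indeed the modulus of the base converges to |ε_1 − ε_0| < 1, so the convergence is geometric with some ratio const < 1 satisfying |ε_1−ε_0| < const < 1. -/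
open Filter Topology

/-- Large-check-degree limit of the Fourier-transform difference (parity
coordinate `k = 1`) for a binary asymmetric channel with crossover
probabilities `ε₀, ε₁`:
`(((1-ε₀+ε₁) e^{i(r/Δ)L₊} - (1+ε₀-ε₁) e^{i(r/Δ)L₋})/2)^Δ → 0`; the modulus
of the base converges to `|ε₁ - ε₀| < 1`, so the convergence is geometric
with some ratio `const` satisfying `|ε₁ - ε₀| < const < 1`. -/
theorem fourier_difference_limit_k1 (ε₀ ε₁ : ℝ) (hε₀ : 0 ≤ ε₀) (hε₁ : 0 ≤ ε₁)
    (hsum : ε₀ + ε₁ < 1) (r : ℝ) (Lp Lm : ℝ)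
    (hLp : Lp = Real.log ((1 - ε₀ + ε₁) / (1 - ε₀ - ε₁)))
    (hLm : Lm = Real.log ((1 + ε₀ - ε₁) / (1 - ε₀ - ε₁))) :
    Tendsto
      (fun Δ : ℕ =>
        ((((1 - ε₀ + ε₁ : ℝ) : ℂ)
              * Complex.exp (Complex.I * ((r / (Δ : ℝ) * Lp : ℝ) : ℂ))
            - ((1 + ε₀ - ε₁ : ℝ) : ℂ)
              * Complex.exp (Complex.I * ((r / (Δ : ℝ) * Lm : ℝ) : ℂ))) / 2)
          ^ Δ)
      atTop (𝓝 0) ∧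
    Tendsto
      (fun Δ : ℕ =>
        norm
          ((((1 - ε₀ + ε₁ : ℝ) : ℂ)
                * Complex.exp (Complex.I * ((r / (Δ : ℝ) * Lp : ℝ) : ℂ))
              - ((1 + ε₀ - ε₁ : ℝ) : ℂ)
                * Complex.exp (Complex.I * ((r / (Δ : ℝ) * Lm : ℝ) : ℂ))) / 2))
      atTop (𝓝 |ε₁ - ε₀|) ∧
    |ε₁ - ε₀| < 1 ∧
    ∃ const : ℝ, |ε₁ - ε₀| < const ∧ const < 1 ∧
      ∀ᶠ Δ : ℕ in atTop,
        norm
            (((((1 - ε₀ + ε₁ : ℝ) : ℂ)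
                  * Complex.exp (Complex.I * ((r / (Δ : ℝ) * Lp : ℝ) : ℂ))
                - ((1 + ε₀ - ε₁ : ℝ) : ℂ)
                  * Complex.exp (Complex.I * ((r / (Δ : ℝ) * Lm : ℝ) : ℂ))) / 2)
              ^ Δ)
          ≤ const ^ Δ := by
  clear hLp hLm
  have hlt : |ε₁ - ε₀| < 1 := by
    rw [abs_lt]; constructor <;> linarith
  have hexp : ∀ L : ℝ, Tendsto (fun Δ : ℕ =>
      Complex.exp (Complex.I * ((r / (Δ : ℝ) * L : ℝ) : ℂ))) atTop (𝓝 1) := by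
    intro L
    have h1 : Tendsto (fun Δ : ℕ => r / (Δ : ℝ) * L) atTop (𝓝 0) := by
      simpa using (tendsto_const_div_atTop_nhds_zero_nat r).mul_const L
    have hc : Continuous (fun x : ℝ => Complex.exp (Complex.I * (x : ℂ))) := by fun_prop
    simpa [Function.comp_def] using (hc.tendsto 0).comp h1
  have hbase := ((((hexp Lp).const_mul ((1 - ε₀ + ε₁ : ℝ) : ℂ)).sub
    ((hexp Lm).const_mul ((1 + ε₀ - ε₁ : ℝ) : ℂ))).div_const 2).norm
  have hval : ‖(((1 - ε₀ + ε₁ : ℝ) : ℂ) * 1 - ((1 + ε₀ - ε₁ : ℝ) : ℂ) * 1) / 2‖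
      = |ε₁ - ε₀| := by
    rw [← Real.norm_eq_abs, ← Complex.norm_real]
    congr 1
    push_cast
    ring
  rw [hval] at hbase
  obtain ⟨c, hc1, hc2⟩ := exists_between hlt
  have hev := hbase.eventually_le_const hc1
  have hgeo := hev.mono fun Δ h => by
    have := pow_le_pow_left₀ (norm_nonneg _) h Δ
    rwa [← norm_pow] at this
  refine ⟨?_, hbase, hlt, c, hc1, hc2, hgeo⟩
  exact squeeze_zero_norm' hgeo
    (tendsto_pow_atTop_nhds_zero_of_lt_one ((abs_nonneg _).trans hc1.le) hc2)
end
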